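/- The unity blowup equation of the M--string theory at base degree one holds: for each characteristic a ∈ {0, 1/2}, each sign s ∈ {+1, −1}, every τ in the upper half-plane ℍ, and all m, ε₁, ε₂ ∈ ℂ, θ₁(τ, ε₂)·θ^{[a]}(2τ, −s·m + (3ε₁ − ε₂)/2)·θ₁(τ, ε₂/2 + m + s·ε₁/2)·θ₁(τ, ε₂/2 − m − s·ε₁/2) − θ₁(τ, ε₁)·θ^{[a]}(2τ, −s·m + (3ε₂ − ε₁)/2)·θ₁(τ, ε₁/2 + m + s·ε₂/2)·θ₁(τ, ε₁/2 − m − s·ε₂/2) = θ₁(τ, ε₂ − ε₁)·θ^{[a]}(2τ, −s·m − (ε₁ + ε₂)/2)·θ₁(τ, (ε₁ + ε₂)/2 + m)·θ₁(τ, (ε₁ + ε₂)/2 − m). -/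

import Mathlib

/-- The Jacobi theta function θ₁(τ,z). -/
noncomputable def theta1 (τ z : ℂ) : ℂ :=
  -Complex.I * ∑' n : ℤ, (-1 : ℂ) ^ n *
    Complex.exp (Real.pi * Complex.I * τ * ((n : ℂ) + 1 / 2) ^ 2 +
      2 * Real.pi * Complex.I * ((n : ℂ) + 1 / 2) * z)

/-- The theta function with characteristic a:
θ^{[a]}(τ,z) = ∑_{n∈ℤ} exp(πiτ(n+a)² + 2πi(n+a)z). -/
noncomputable def thetaChar (a : ℝ) (τ z : ℂ) : ℂ :=
  ∑' n : ℤ, Complex.exp (Real.pi * Complex.I * τ * ((n : ℂ) + (a : ℂ)) ^ 2 +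
    2 * Real.pi * Complex.I * ((n : ℂ) + (a : ℂ)) * z)

open Complex in
/-- The terms of a theta series with characteristic are summable. -/
lemma summable_thetaChar_term (a : ℝ) {τ : ℂ} (hτ : 0 < τ.im) (z : ℂ) :
    Summable fun n : ℤ => exp (Real.pi * I * τ * ((n : ℂ) + (a : ℂ)) ^ 2 +
      2 * Real.pi * I * ((n : ℂ) + (a : ℂ)) * z) := by
  refine (((summable_jacobiTheta₂_term_iff (z + a * τ) τ).2 hτ).mul_left
    (exp (Real.pi * I * τ * a ^ 2 + 2 * Real.pi * I * a * z))).congr fun n => ?_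
  rw [jacobiTheta₂_term, ← exp_add]
  congr 1
  ring

open Complex in
/-- The terms of the series defining `theta1` are summable. -/
lemma summable_theta1_term {τ : ℂ} (hτ : 0 < τ.im) (z : ℂ) :
    Summable fun n : ℤ => (-1 : ℂ) ^ n * exp (Real.pi * I * τ * ((n : ℂ) + 1 / 2) ^ 2 +
      2 * Real.pi * I * ((n : ℂ) + 1 / 2) * z) := by
  refine Summable.of_norm ((summable_thetaChar_term (1 / 2) hτ z).norm.congr fun n => ?_)
  simp

/-- Theta functions of characteristic `0` and `1 / 2` are even. -/
lemma thetaChar_neg {a : ℝ} (ha : a = 0 ∨ a = 1 / 2) (τ z : ℂ) :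
    thetaChar a τ (-z) = thetaChar a τ z := by
  unfold thetaChar
  rcases ha with rfl | rfl
  · rw [← (Equiv.neg ℤ).tsum_eq]
    refine tsum_congr fun n => congrArg _ ?_
    simp only [Equiv.neg_apply]
    push_cast
    ring
  · rw [← (Equiv.subLeft (-1 : ℤ)).tsum_eq]
    refine tsum_congr fun n => congrArg _ ?_
    simp only [Equiv.subLeft_apply]
    push_cast
    ring

/-- Pairs of integers `(n, k)`, split by the parity of `n - k`. -/
noncomputable def parityEquiv : (ℤ × ℤ) ⊕ (ℤ × ℤ) ≃ ℤ × ℤ :=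
  Equiv.ofBijective
    (Sum.elim (fun p => (p.1 + p.2, p.1 - p.2)) fun p => (p.1 + p.2, p.1 - p.2 - 1)) <| by
    constructor
    · rintro (⟨r, t⟩ | ⟨r, t⟩) (⟨r', t'⟩ | ⟨r', t'⟩) h <;>
        simp only [Sum.elim_inl, Sum.elim_inr, Prod.mk.injEq, Sum.inl.injEq, Sum.inr.injEq,
          reduceCtorEq] at h ⊢ <;> omega
    · rintro ⟨n, k⟩
      rcases Int.even_or_odd' (n - k) with ⟨t, h | h⟩
      · exact ⟨.inl (n - t, t), by simp only [Sum.elim_inl, Prod.mk.injEq]; omega⟩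
      · exact ⟨.inr (n - t, t), by simp only [Sum.elim_inr, Prod.mk.injEq]; omega⟩

/-- A sum over pairs of integers `(n, k)`, split by the parity of `n - k`. -/
lemma tsum_parity_split {f : ℤ × ℤ → ℂ} (hf : Summable f) :
    ∑' p : ℤ × ℤ, f (p.1 + p.2, p.1 - p.2) + ∑' p : ℤ × ℤ, f (p.1 + p.2, p.1 - p.2 - 1) =
      ∑' p, f p := by
  have hs := parityEquiv.summable_iff.2 hf
  rw [← parityEquiv.tsum_eq f]
  exact (Summable.tsum_sum (hs.comp_injective Sum.inl_injective)
    (hs.comp_injective Sum.inr_injective)).symm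

open Complex in
/-- A product of two theta functions at `τ` in terms of theta functions at `2 * τ`. -/
lemma theta1_mul_theta1 {τ : ℂ} (hτ : 0 < τ.im) (x y : ℂ) :
    theta1 τ x * theta1 τ y =
      thetaChar 0 (2 * τ) (x + y) * thetaChar (1 / 2) (2 * τ) (x - y) -
        thetaChar (1 / 2) (2 * τ) (x + y) * thetaChar 0 (2 * τ) (x - y) := by
  have hτ' : 0 < (2 * τ).im := by simpa using hτ
  have hsx := (summable_theta1_term hτ x).norm
  have hsy := (summable_theta1_term hτ y).norm
  have hI (A B : ℂ) : -I * A * (-I * B) = -(A * B) := by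
    linear_combination A * B * I_sq
  rw [theta1, theta1, hI, tsum_mul_tsum_of_summable_norm hsx hsy, ← tsum_parity_split
    (summable_mul_of_summable_norm hsx hsy)]
  unfold thetaChar
  rw [tsum_mul_tsum_of_summable_norm (summable_thetaChar_term _ hτ' _).norm
    (summable_thetaChar_term _ hτ' _).norm,
    tsum_mul_tsum_of_summable_norm (summable_thetaChar_term _ hτ' _).norm
    (summable_thetaChar_term _ hτ' _).norm]
  have hne : (-1 : ℂ) ≠ 0 := by norm_num
  rw [neg_add, sub_eq_add_neg, add_comm, ← tsum_neg]
  congr 1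
  · refine tsum_congr fun ⟨r, t⟩ => ?_
    have hsign : (-1 : ℂ) ^ (r + t) * (-1 : ℂ) ^ (r - t - 1) = -1 := by
      rw [← zpow_add₀ hne, show r + t + (r - t - 1) = 2 * (r - 1) + 1 by ring,
        Odd.neg_one_zpow ⟨r - 1, rfl⟩]
    rw [mul_mul_mul_comm, hsign, ← exp_add, ← exp_add, neg_one_mul, neg_neg]
    congr 1
    push_cast
    ring
  · refine congrArg _ (tsum_congr fun ⟨r, t⟩ => ?_)
    have hsign : (-1 : ℂ) ^ (r + t) * (-1 : ℂ) ^ (r - t) = 1 := by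
      rw [← zpow_add₀ hne, show r + t + (r - t) = 2 * r by ring,
        Even.neg_one_zpow (even_two_mul r)]
    rw [mul_mul_mul_comm, hsign, ← exp_add, ← exp_add, one_mul]
    congr 1
    push_cast
    ring

/-- The blowup equation for the positive sign. -/
lemma blowup_equation_pos {a : ℝ} (ha : a = 0 ∨ a = 1 / 2) {τ : ℂ} (hτ : 0 < τ.im)
    (m ε₁ ε₂ : ℂ) :
    theta1 τ ε₂ * thetaChar a (2 * τ) (-m + (3 * ε₁ - ε₂) / 2) *
        theta1 τ ((ε₁ + ε₂) / 2 + m) * theta1 τ ((ε₂ - ε₁) / 2 - m) -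
      theta1 τ ε₁ * thetaChar a (2 * τ) (-m + (3 * ε₂ - ε₁) / 2) *
        theta1 τ ((ε₁ + ε₂) / 2 + m) * theta1 τ ((ε₁ - ε₂) / 2 - m) =
    theta1 τ (ε₂ - ε₁) * thetaChar a (2 * τ) (-m - (ε₁ + ε₂) / 2) *
      theta1 τ ((ε₁ + ε₂) / 2 + m) * theta1 τ ((ε₁ + ε₂) / 2 - m) := by
  have h₁ := theta1_mul_theta1 hτ ε₂ ((ε₂ - ε₁) / 2 - m)
  have h₂ := theta1_mul_theta1 hτ ε₁ ((ε₁ - ε₂) / 2 - m)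
  have h₃ := theta1_mul_theta1 hτ (ε₂ - ε₁) ((ε₁ + ε₂) / 2 - m)
  rw [show ε₂ + ((ε₂ - ε₁) / 2 - m) = -m + (3 * ε₂ - ε₁) / 2 by ring,
    show ε₂ - ((ε₂ - ε₁) / 2 - m) = -(-m - (ε₁ + ε₂) / 2) by ring,
    thetaChar_neg (.inl rfl), thetaChar_neg (.inr rfl)] at h₁
  rw [show ε₁ + ((ε₁ - ε₂) / 2 - m) = -m + (3 * ε₁ - ε₂) / 2 by ring,
    show ε₁ - ((ε₁ - ε₂) / 2 - m) = -(-m - (ε₁ + ε₂) / 2) by ring,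
    thetaChar_neg (.inl rfl), thetaChar_neg (.inr rfl)] at h₂
  rw [show ε₂ - ε₁ + ((ε₁ + ε₂) / 2 - m) = -m + (3 * ε₂ - ε₁) / 2 by ring,
    show ε₂ - ε₁ - ((ε₁ + ε₂) / 2 - m) = -(-m + (3 * ε₁ - ε₂) / 2) by ring,
    thetaChar_neg (.inl rfl), thetaChar_neg (.inr rfl)] at h₃
  rcases ha with rfl | rfl
  · linear_combination theta1 τ ((ε₁ + ε₂) / 2 + m) *
      (thetaChar 0 (2 * τ) (-m + (3 * ε₁ - ε₂) / 2) * h₁ -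
        thetaChar 0 (2 * τ) (-m + (3 * ε₂ - ε₁) / 2) * h₂ -
        thetaChar 0 (2 * τ) (-m - (ε₁ + ε₂) / 2) * h₃)
  · linear_combination theta1 τ ((ε₁ + ε₂) / 2 + m) *
      (thetaChar (1 / 2) (2 * τ) (-m + (3 * ε₁ - ε₂) / 2) * h₁ -
        thetaChar (1 / 2) (2 * τ) (-m + (3 * ε₂ - ε₁) / 2) * h₂ -
        thetaChar (1 / 2) (2 * τ) (-m - (ε₁ + ε₂) / 2) * h₃)

/-- The unity blowup equation of the M--string theory at base degree one. -/
theorem statement9 (a : ℝ) (ha : a = 0 ∨ a = 1 / 2) (s : ℂ) (hs : s = 1 ∨ s = -1)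
    (τ : ℂ) (hτ : 0 < τ.im) (m ε₁ ε₂ : ℂ) :
    theta1 τ ε₂ * thetaChar a (2 * τ) (-(s * m) + (3 * ε₁ - ε₂) / 2) *
        theta1 τ (ε₂ / 2 + m + s * ε₁ / 2) * theta1 τ (ε₂ / 2 - m - s * ε₁ / 2) -
      theta1 τ ε₁ * thetaChar a (2 * τ) (-(s * m) + (3 * ε₂ - ε₁) / 2) *
        theta1 τ (ε₁ / 2 + m + s * ε₂ / 2) * theta1 τ (ε₁ / 2 - m - s * ε₂ / 2) =
    theta1 τ (ε₂ - ε₁) * thetaChar a (2 * τ) (-(s * m) - (ε₁ + ε₂) / 2) *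
      theta1 τ ((ε₁ + ε₂) / 2 + m) * theta1 τ ((ε₁ + ε₂) / 2 - m) := by
  rcases hs with rfl | rfl
  · rw [one_mul, show ε₂ / 2 + m + 1 * ε₁ / 2 = (ε₁ + ε₂) / 2 + m by ring,
      show ε₂ / 2 - m - 1 * ε₁ / 2 = (ε₂ - ε₁) / 2 - m by ring,
      show ε₁ / 2 + m + 1 * ε₂ / 2 = (ε₁ + ε₂) / 2 + m by ring,
      show ε₁ / 2 - m - 1 * ε₂ / 2 = (ε₁ - ε₂) / 2 - m by ring]
    exact blowup_equation_pos ha hτ m ε₁ ε₂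
  · rw [neg_one_mul, show ε₂ / 2 + m + -1 * ε₁ / 2 = (ε₂ - ε₁) / 2 - -m by ring,
      show ε₂ / 2 - m - -1 * ε₁ / 2 = (ε₁ + ε₂) / 2 + -m by ring,
      show ε₁ / 2 + m + -1 * ε₂ / 2 = (ε₁ - ε₂) / 2 - -m by ring,
      show ε₁ / 2 - m - -1 * ε₂ / 2 = (ε₁ + ε₂) / 2 + -m by ring,
      show (ε₁ + ε₂) / 2 + m = (ε₁ + ε₂) / 2 - -m by ring,
      show (ε₁ + ε₂) / 2 - m = (ε₁ + ε₂) / 2 + -m by ring]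
    linear_combination blowup_equation_pos ha hτ (-m) ε₁ ε₂
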